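/- In U, if n ≥ 2 (so that the simple root α_1 is even, [α_1] = 0), then ⟦χ_1⁺, ⟦χ_1⁺, ⟦χ_2⁺, ⟦χ_1⁺, χ_0⁺⟧⟧⟧⟧ = 0. -/

import Mathlib

noncomputable section

open Finset

/-- The base field `K = ℂ(v)`, with `v = q^{1/2}`. -/
abbrev KK : Type := RatFunc ℂ

/-- The variable `v = q^{1/2}`; thus `q^{a} = vv ^ (2*a)`. -/
def vv : KK := RatFunc.X

/-- `(ε_{k+1}, ε_{k+1})` for `0 ≤ k < N` (0-indexed). -/
def epsSq (n k : ℕ) : ℤ := if k < n then -1 else 1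

/-- coefficient of `ε_{k+1}` (0-indexed `k`) in the simple root `α_i`, `0 ≤ i ≤ m+n`. -/
def co (m n i k : ℕ) : ℤ :=
  if i = 0 then (if k = 0 then -2 else 0)
  else if i = m + n then (if k + 1 = m + n then 1 else 0)
  else (if k + 1 = i then 1 else 0) - (if k = i then 1 else 0)

/-- `(α_i, α_j)`. -/
def Bmat (m n i j : ℕ) : ℤ :=
  ∑ k ∈ Finset.range (m + n), epsSq n k * co m n i k * co m n j k

/-- Bilinear form on weights written in the `α`-basis (coords `ℕ → ℤ`). -/
def Bw (m n : ℕ) (a b : ℕ → ℤ) : ℤ :=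
  ∑ i ∈ Finset.range (m + n + 1), ∑ j ∈ Finset.range (m + n + 1), a i * b j * Bmat m n i j

/-- the weight `α_i` in `α`-coordinates. -/
def uw (i : ℕ) : ℕ → ℤ := fun j => if j = i then 1 else 0

/-- the sign `(-1)^{[a][b]}`: the parity of a weight `a` is `a n mod 2`. -/
def sg (n : ℕ) (a b : ℕ → ℤ) : KK := (-1 : KK) ^ (a n * b n)

/-- the coefficient `(-1)^{[a][b]} q^{-(a,b)}` appearing in `⟦·,·⟧`. -/
def qcf (m n : ℕ) (a b : ℕ → ℤ) : KK := sg n a b * vv ^ (-2 * Bw m n a b)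

/-- `q_i = vv ^ qexp i`. -/
def qexp (m n i : ℕ) : ℤ := if Bmat m n i i = 0 then 2 else |Bmat m n i i|

/-- the quantum integer `[a]_i`. -/
def qint (m n i : ℕ) (a : ℤ) : KK :=
  (vv ^ (qexp m n i * a) - vv ^ (-(qexp m n i * a))) / (vv ^ qexp m n i - vv ^ (-qexp m n i))

/-- the matrix `A_{ij}`. -/
def Amat (m n i j : ℕ) : ℤ := if i = m + n then 2 * Bmat m n i j else Bmat m n i j

section brackets
variable {A : Type*} [Ring A] [Algebra KK A]

/-- `[x, y]_c = x y - c • (y x)`. -/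
def cbr (c : KK) (x y : A) : A := x * y - c • (y * x)

/-- supercommutator of homogeneous elements of weights `a`, `b`. -/
def sbr (n : ℕ) (a b : ℕ → ℤ) (x y : A) : A := cbr (sg n a b) x y

/-- the bracket `⟦x, y⟧` for homogeneous elements of weights `a`, `b`. -/
def qbr (m n : ℕ) (a b : ℕ → ℤ) (x y : A) : A := cbr (qcf m n a b) x y

end brackets

/-- total weight of a list of simple-root indices. -/
def lwt (l : List ℕ) : ℕ → ℤ := l.foldr (fun j w => uw j + w) 0

/-- right-nested `⟦·,⟦·,…⟧⟧` of a list of simple root vectors `e j`. -/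
def qfoldr (m n : ℕ) {A : Type*} [Ring A] [Algebra KK A] (e : ℕ → A) : List ℕ → A
  | [] => 1
  | [j] => e j
  | j :: rest => qbr m n (uw j) (lwt rest) (e j) (qfoldr m n e rest)

/-! ## The Drinfeld–Jimbo presentation `U = U_q[osp(2m+1|2n)^{(1)}]` -/

/-- Generators of `U`. -/
inductive UGen (m n : ℕ) : Type
  | cp (i : Fin (m + n + 1))   -- χ_i⁺
  | cm (i : Fin (m + n + 1))   -- χ_i⁻
  | kk (i : Fin (m + n + 1))   -- K_i
  | ki (i : Fin (m + n + 1))   -- K_i⁻¹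
  | kd                          -- K_δ^{1/2}
  | kdi                         -- K_δ^{-1/2}

/-- Free algebra on the generators of `U`. -/
abbrev UF (m n : ℕ) : Type := FreeAlgebra KK (UGen m n)

def uidx (m n : ℕ) (i : ℕ) : Fin (m + n + 1) := ⟨i % (m + n + 1), Nat.mod_lt _ (Nat.succ_pos _)⟩

def fcp (m n : ℕ) (i : ℕ) : UF m n := FreeAlgebra.ι KK (UGen.cp (uidx m n i))
def fcm (m n : ℕ) (i : ℕ) : UF m n := FreeAlgebra.ι KK (UGen.cm (uidx m n i))
def fk (m n : ℕ) (i : ℕ) : UF m n := FreeAlgebra.ι KK (UGen.kk (uidx m n i))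
def fki (m n : ℕ) (i : ℕ) : UF m n := FreeAlgebra.ι KK (UGen.ki (uidx m n i))
def fkd (m n : ℕ) : UF m n := FreeAlgebra.ι KK (UGen.kd)
def fkdi (m n : ℕ) : UF m n := FreeAlgebra.ι KK (UGen.kdi)
/-- `χ_i^σ`, `σ = true` for `+`. -/
def fx (m n : ℕ) (σ : Bool) (i : ℕ) : UF m n := if σ then fcp m n i else fcm m n i

/-- left-hand side of DJ9. -/
def dj9lhs (m n : ℕ) (σ : Bool) : UF m n :=
  sbr n (uw 3 + uw 2 + uw 1 + uw 0 + uw 1 + uw 2) (uw 1)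
   (qbr m n (uw 3 + uw 2 + uw 1 + uw 0 + uw 1) (uw 2)
    (qbr m n (uw 3 + uw 2 + uw 1 + uw 0) (uw 1)
     (qbr m n (uw 3 + uw 2 + uw 1) (uw 0)
      (qbr m n (uw 3 + uw 2) (uw 1)
       (qbr m n (uw 3) (uw 2) (fx m n σ 3) (fx m n σ 2))
       (fx m n σ 1))
      (fx m n σ 0))
     (fx m n σ 1))
    (fx m n σ 2))
   (fx m n σ 1)

/-- `⟦χ_2^σ, χ_1^σ⟧`. -/
def dj10A (m n : ℕ) (σ : Bool) : UF m n := qbr m n (uw 2) (uw 1) (fx m n σ 2) (fx m n σ 1)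

/-- left-hand side of DJ10. -/
def dj10lhs (m n : ℕ) (σ : Bool) : UF m n :=
  qbr m n (uw 2 + uw 1) ((uw 2 + uw 1) + ((uw 2 + uw 1) + uw 0)) (dj10A m n σ)
   (qbr m n (uw 2 + uw 1) ((uw 2 + uw 1) + uw 0) (dj10A m n σ)
    (qbr m n (uw 2 + uw 1) (uw 0) (dj10A m n σ) (fx m n σ 0)))

/-- right-hand side of DJ10 (without the scalar). -/
def dj10rhs (m n : ℕ) (σ : Bool) : UF m n :=
  qbr m n ((uw 2 + uw 1) + (uw 2 + (uw 2 + (uw 1 + uw 0)))) (uw 1)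
   (qbr m n (uw 2 + uw 1) (uw 2 + (uw 2 + (uw 1 + uw 0))) (dj10A m n σ)
    (qbr m n (uw 2) (uw 2 + (uw 1 + uw 0)) (fx m n σ 2)
     (qbr m n (uw 2) (uw 1 + uw 0) (fx m n σ 2)
      (qbr m n (uw 1) (uw 0) (fx m n σ 1) (fx m n σ 0)))))
   (fx m n σ 1)

/-- The defining relations (DJ1)–(DJ11) of `U_q[osp(2m+1|2n)^{(1)}]`. -/
inductive URel (m n : ℕ) : UF m n → UF m n → Prop
  | k_inv (i : ℕ) (hi : i ≤ m + n) : URel m n (fk m n i * fki m n i) 1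
  | inv_k (i : ℕ) (hi : i ≤ m + n) : URel m n (fki m n i * fk m n i) 1
  | k_k (i j : ℕ) (hi : i ≤ m + n) (hj : j ≤ m + n) :
      URel m n (fk m n i * fk m n j) (fk m n j * fk m n i)
  | k_x (σ : Bool) (i j : ℕ) (hi : i ≤ m + n) (hj : j ≤ m + n) :
      URel m n (fk m n i * fx m n σ j * fki m n i)
           ((vv ^ ((if σ then 2 else -2) * Bmat m n i j)) • fx m n σ j)
  | xp_xm (i j : ℕ) (hi : i ≤ m + n) (hj : j ≤ m + n) :
      URel m n (sbr n (uw i) (uw j) (fcp m n i) (fcm m n j))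
           (if i = j then (vv ^ qexp m n i - vv ^ (-qexp m n i))⁻¹ • (fk m n i - fki m n i) else 0)
  | x_x (σ : Bool) (i j : ℕ) (hi : i ≤ m + n) (hj : j ≤ m + n) (h0 : Bmat m n i j = 0) :
      URel m n (sbr n (uw i) (uw j) (fx m n σ i) (fx m n σ j)) 0
  | serre_up (σ : Bool) (i : ℕ) (hi : i < m + n) (hn : i ≠ n) :
      URel m n (qbr m n (uw i) (uw i + uw (i+1)) (fx m n σ i)
             (qbr m n (uw i) (uw (i+1)) (fx m n σ i) (fx m n σ (i+1)))) 0
  | serre_dn (σ : Bool) (i : ℕ) (h1 : 1 < i) (hi : i < m + n) (hn : i ≠ n) :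
      URel m n (qbr m n (uw i) (uw i + uw (i-1)) (fx m n σ i)
             (qbr m n (uw i) (uw (i-1)) (fx m n σ i) (fx m n σ (i-1)))) 0
  | serre3 (σ : Bool) (i : ℕ) (hi : i = 1 ∨ i = m + n) :
      URel m n (qbr m n (uw i) (uw i + (uw i + uw (i-1))) (fx m n σ i)
             (qbr m n (uw i) (uw i + uw (i-1)) (fx m n σ i)
               (qbr m n (uw i) (uw (i-1)) (fx m n σ i) (fx m n σ (i-1))))) 0
  | serre4 (σ : Bool) (hn : 1 < n) :
      URel m n (sbr n (uw (n-1) + uw n + uw (n+1)) (uw n)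
             (qbr m n (uw (n-1) + uw n) (uw (n+1))
               (qbr m n (uw (n-1)) (uw n) (fx m n σ (n-1)) (fx m n σ n)) (fx m n σ (n+1)))
             (fx m n σ n)) 0
  | serre5 (σ : Bool) (hn : n = 1) (hm : 2 ≤ m) : URel m n (dj9lhs m n σ) 0
  | serre6 (σ : Bool) (hn : n = 1) (hm : m = 1) :
      URel m n (dj10lhs m n σ) ((1 - qint m n 1 2) • dj10rhs m n σ)
  | kd_inv : URel m n (fkd m n * fkdi m n) 1
  | inv_kd : URel m n (fkdi m n * fkd m n) 1
  | kd_sq : URel m n (fkd m n * fkd m n)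
      (fk m n 0 * ((List.range (m + n)).map (fun i => fk m n (i+1) * fk m n (i+1))).prod)
  | kd_c (y : UGen m n) : URel m n (fkd m n * FreeAlgebra.ι KK y) (FreeAlgebra.ι KK y * fkd m n)
  | kdi_c (y : UGen m n) : URel m n (fkdi m n * FreeAlgebra.ι KK y) (FreeAlgebra.ι KK y * fkdi m n)

/-- The Drinfeld–Jimbo quantum affine superalgebra `U_q[osp(2m+1|2n)^{(1)}]`. -/
abbrev UAlg (m n : ℕ) : Type := RingQuot (URel m n)

def mkU (m n : ℕ) : UF m n →ₐ[KK] UAlg m n := RingQuot.mkAlgHom KK (URel m n)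

def cp (m n : ℕ) (i : ℕ) : UAlg m n := mkU m n (fcp m n i)
def cm (m n : ℕ) (i : ℕ) : UAlg m n := mkU m n (fcm m n i)
def kU (m n : ℕ) (i : ℕ) : UAlg m n := mkU m n (fk m n i)
def kiU (m n : ℕ) (i : ℕ) : UAlg m n := mkU m n (fki m n i)
def kdU (m n : ℕ) : UAlg m n := mkU m n (fkd m n)
def kdiU (m n : ℕ) : UAlg m n := mkU m n (fkdi m n)

open Polynomial in
theorem vv_quantum_three_ne_zero :
    ((vv ^ 2) ^ 4 + (vv ^ 2) ^ 2 + 1 : KK) ≠ 0 := by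
  have h : ((vv ^ 2) ^ 4 + (vv ^ 2) ^ 2 + 1 : KK) =
      algebraMap ℂ[X] KK ((X ^ 2) ^ 4 + (X ^ 2) ^ 2 + 1) := by
    simp [vv, RatFunc.algebraMap_X]
  rw [h]
  refine RatFunc.algebraMap_ne_zero fun h0 => ?_
  simpa using congrArg (Polynomial.eval 0) h0

theorem vv_ne_zero : vv ≠ 0 := RatFunc.X_ne_zero

/-- If `a, b` satisfy the quadratic and `a, c` the cubic quantum Serre relation, and `b, c` commute,
then the iterated twisted bracket of `a, a, b, a, c` vanishes. -/
theorem twisted_bracket_nested_eq_zero {K A : Type*} [Field K] [Ring A] [Algebra K A]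
    (f : K → A → A → A) (hf : ∀ r x y, f r x y = x * y - r • (y * x)) {q : K} (hq : q ≠ 0)
    (hD : q ^ 4 + q ^ 2 + 1 ≠ 0) {a b c : A}
    (hab : f q a (f q⁻¹ a b) = 0)
    (hac : f (q ^ 2) a (f 1 a (f (q ^ 2)⁻¹ a c)) = 0)
    (hcb : f 1 c b = 0) :
    f q a (f q⁻¹ a (f q⁻¹ b (f (q ^ 2)⁻¹ a c))) = 0 := by
  have hD' : q ^ 2 * (q ^ 2 + 1) + 1 ≠ 0 := by
    convert hD using 1
    ring
  have key : f q a (f q⁻¹ a (f q⁻¹ b (f (q ^ 2)⁻¹ a c))) =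
      (q ^ 3)⁻¹ • (a * c * f q a (f q⁻¹ a b))
      - (q * (q ^ 4 + q ^ 2 + 1))⁻¹ • (c * a * f q a (f q⁻¹ a b))
      - (q * (q ^ 2 + 1) / (q ^ 4 + q ^ 2 + 1)) • (a * f q a (f q⁻¹ a b) * c)
      - ((q ^ 2 + 1) / (q ^ 2 * (q ^ 4 + q ^ 2 + 1))) • (c * f q a (f q⁻¹ a b) * a)
      - (q ^ 2 / (q ^ 4 + q ^ 2 + 1)) • (f q a (f q⁻¹ a b) * (a * c))
      + f q a (f q⁻¹ a b) * (c * a)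
      + (q ^ 2 / (q ^ 4 + q ^ 2 + 1)) •
        (b * f (q ^ 2) a (f 1 a (f (q ^ 2)⁻¹ a c)))
      - (q * (q ^ 4 + q ^ 2 + 1))⁻¹ •
        (f (q ^ 2) a (f 1 a (f (q ^ 2)⁻¹ a c)) * b)
      + ((q ^ 2 + 1) / (q ^ 2 * (q ^ 4 + q ^ 2 + 1))) • (f 1 c b * (a * a * a))
      - ((q ^ 2 + 1) / q ^ 3) • (a * f 1 c b * (a * a))
      + ((q ^ 2 + 1) / q ^ 2) • (a * a * f 1 c b * a)
      - (q * (q ^ 2 + 1) / (q ^ 4 + q ^ 2 + 1)) • (a * a * a * f 1 c b) := by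
    simp only [hf, mul_sub, sub_mul, smul_sub, smul_mul_assoc, mul_smul_comm, mul_assoc]
    match_scalars <;> field_simp
    all_goals ring
  rw [key, hab, hac, hcb]
  simp

theorem Bmat_comm (m n i j : ℕ) : Bmat m n i j = Bmat m n j i :=
  Finset.sum_congr rfl fun _ _ => by ring

theorem Bw_add_right (m n : ℕ) (a b c : ℕ → ℤ) : Bw m n a (b + c) = Bw m n a b + Bw m n a c := by
  simp [Bw, mul_add, add_mul, Finset.sum_add_distrib]

theorem Bw_uw (m n : ℕ) {i j : ℕ} (hi : i ≤ m + n) (hj : j ≤ m + n) :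
    Bw m n (uw i) (uw j) = Bmat m n i j := by
  simp [Bw, uw, ite_mul, Finset.sum_ite_eq', hi, hj]

/-- Only the first two coordinates matter when pairing with `α_0` or `α_1`. -/
theorem Bmat_eq_of_lt_two (m n i j : ℕ) (hm : 1 ≤ m) (hn : 2 ≤ n) (hi : i < 2) :
    Bmat m n i j = -(co m n i 0 * co m n j 0) - co m n i 1 * co m n j 1 := by
  have hsub : Finset.range 2 ⊆ Finset.range (m + n) :=
    Finset.range_subset_range.2 (by omega)
  have hz : ∀ k ∈ Finset.range (m + n), k ∉ Finset.range 2 →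
      epsSq n k * co m n i k * co m n j k = 0 := by
    intro k _ hk
    have hk2 : 2 ≤ k := by simpa [Nat.succ_le_iff] using hk
    have : co m n i k = 0 := by
      unfold co
      split_ifs <;> omega
    simp [this]
  have h0 : epsSq n 0 = -1 := if_pos (by omega)
  have h1 : epsSq n 1 = -1 := if_pos (by omega)
  rw [Bmat, ← Finset.sum_subset hsub hz, Finset.sum_range_succ, Finset.sum_range_one, h0, h1]
  ring

theorem Bmat_zero_one (m n : ℕ) (hm : 1 ≤ m) (hn : 2 ≤ n) : Bmat m n 0 1 = 2 := by
  have h : 1 ≠ m + n := by omega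
  rw [Bmat_eq_of_lt_two m n 0 1 hm hn (by omega)]
  simp [co, h]

theorem Bmat_zero_two (m n : ℕ) (hm : 1 ≤ m) (hn : 2 ≤ n) : Bmat m n 0 2 = 0 := by
  have h : 2 ≠ m + n := by omega
  rw [Bmat_eq_of_lt_two m n 0 2 hm hn (by omega)]
  simp [co, h]

theorem Bmat_one_one (m n : ℕ) (hm : 1 ≤ m) (hn : 2 ≤ n) : Bmat m n 1 1 = -2 := by
  have h : 1 ≠ m + n := by omega
  rw [Bmat_eq_of_lt_two m n 1 1 hm hn (by omega)]
  simp [co, h]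

theorem Bmat_one_two (m n : ℕ) (hm : 1 ≤ m) (hn : 2 ≤ n) : Bmat m n 1 2 = 1 := by
  have h : 1 ≠ m + n := by omega
  have h' : 2 ≠ m + n := by omega
  rw [Bmat_eq_of_lt_two m n 1 2 hm hn (by omega)]
  simp [co, h, h']

theorem mkU_cbr (m n : ℕ) (c : KK) (x y : UF m n) :
    mkU m n (cbr c x y) = cbr c (mkU m n x) (mkU m n y) := by
  simp [cbr]

theorem mkU_eq_of_rel {m n : ℕ} {x y : UF m n} (h : URel m n x y) : mkU m n x = mkU m n y :=
  RingQuot.mkAlgHom_rel KK h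

/-- in `U`, if `n ≥ 2` (so that `α_1` is even),
then `⟦χ_1⁺, ⟦χ_1⁺, ⟦χ_2⁺, ⟦χ_1⁺, χ_0⁺⟧⟧⟧⟧ = 0`. -/
theorem nested_bracket_vanishes_of_two_le_n
    (m n : ℕ) (hm : 1 ≤ m) (hn : 2 ≤ n) :
    qbr m n (uw 1) (uw 1 + (uw 2 + (uw 1 + uw 0))) (cp m n 1)
      (qbr m n (uw 1) (uw 2 + (uw 1 + uw 0)) (cp m n 1)
        (qbr m n (uw 2) (uw 1 + uw 0) (cp m n 2)
          (qbr m n (uw 1) (uw 0) (cp m n 1) (cp m n 0)))) = 0 := by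
  have b01 := Bmat_zero_one m n hm hn
  have b02 := Bmat_zero_two m n hm hn
  have b11 := Bmat_one_one m n hm hn
  have b12 := Bmat_one_two m n hm hn
  have w10 : Bw m n (uw 1) (uw 0) = 2 := by
    rw [Bw_uw m n (by omega) (by omega), Bmat_comm, b01]
  have w20 : Bw m n (uw 2) (uw 0) = 0 := by
    rw [Bw_uw m n (by omega) (by omega), Bmat_comm, b02]
  have w11 : Bw m n (uw 1) (uw 1) = -2 := by rw [Bw_uw m n (by omega) (by omega), b11]
  have w12 : Bw m n (uw 1) (uw 2) = 1 := by rw [Bw_uw m n (by omega) (by omega), b12]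
  have w21 : Bw m n (uw 2) (uw 1) = 1 := by
    rw [Bw_uw m n (by omega) (by omega), Bmat_comm, b12]
  have n0 : n ≠ 0 := by omega
  have n1 : n ≠ 1 := by omega
  have hab := mkU_eq_of_rel (URel.serre_up (m := m) true 1 (by omega) n1.symm)
  have hac := mkU_eq_of_rel (URel.serre3 (m := m) (n := n) true 1 (Or.inl rfl))
  have hcb := mkU_eq_of_rel (URel.x_x true 0 2 (by omega) (by omega) b02)
  have e2 : vv ^ (2 : ℤ) = vv ^ 2 := zpow_natCast vv 2
  have e4 : vv ^ (4 : ℤ) = (vv ^ 2) ^ 2 := by rw [← pow_mul]; exact zpow_natCast vv 4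
  simp [qbr, sbr, mkU_cbr, qcf, sg, Bw_add_right, w10, w11, w12, uw, n0, n1, fx, zpow_neg,
    e2, e4] at hab hac hcb
  have := twisted_bracket_nested_eq_zero cbr (fun _ _ _ => rfl)
    (pow_ne_zero 2 vv_ne_zero) vv_quantum_three_ne_zero hab hac hcb
  simpa [cp, qbr, qcf, sg, Bw_add_right, w10, w11, w12, w20, w21, uw, n0, n1, zpow_neg, e2, e4]
    using this
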